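/- arXiv:1609.08564 — 3 statements merged into one kernel-verified Lean document; each statement's English description precedes it below -/
import Mathlib

section
/- (Reciprocity of the backstepping kernels.) Fix α > 0, λ > 0 and s > 0. Define P(x,y) = (λ y/(2α)) Σ_{n=0}^∞ (λ(y² − x²)/(4α))^n/(n!(n+1)!) and Q(x,y) = (λ y/(2α)) Σ_{n=0}^∞ (−1)^n (λ(y² − x²)/(4α))^n/(n!(n+1)!). Then for every continuous function f on [0, s], defining g(x) = f(x) + ∫_x^s P(x,y) f(y) dy, one recovers f(x) = g(x) − ∫_x^s Q(x,y) g(y) dy for all x ∈ [0, s]; i.e., the Volterra transformation with kernel Q is the inverse of the Volterra transformation with kernel P. -/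
open intervalIntegral

/-- `P(x,y) = (λ/α) y I₁(√(λ(y²−x²)/α))/√(λ(y²−x²)/α)
            = (λ y/(2α)) Σ_{n≥0} (λ(y²−x²)/(4α))ⁿ/(n!(n+1)!)`. -/
noncomputable def PKernel (α lam x y : ℝ) : ℝ :=
  (lam * y / (2 * α)) *
    ∑' n : ℕ, (lam * (y^2 - x^2) / (4*α))^n / ((n.factorial : ℝ) * ((n+1).factorial : ℝ))

/-- `Q(x,y) = (λ/α) y J₁(√(λ(y²−x²)/α))/√(λ(y²−x²)/α)
            = (λ y/(2α)) Σ_{n≥0} (−1)ⁿ (λ(y²−x²)/(4α))ⁿ/(n!(n+1)!)`. -/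
noncomputable def QKernel (α lam x y : ℝ) : ℝ :=
  (lam * y / (2 * α)) *
    ∑' n : ℕ,
      (-1)^n * (lam * (y^2 - x^2) / (4*α))^n / ((n.factorial : ℝ) * ((n+1).factorial : ℝ))

open MeasureTheory Set

/-- The entire function `z ↦ ∑ zⁿ/(n!(n+1)!)`, of which both kernels are rescalings. -/
noncomputable def besselSeries (z : ℝ) : ℝ :=
  ∑' n : ℕ, z ^ n / ((n.factorial : ℝ) * ((n + 1).factorial : ℝ))

theorem abs_besselSeries_term_le {z r : ℝ} (h : |z| ≤ r) (n : ℕ) :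
    ‖z ^ n / ((n.factorial : ℝ) * ((n + 1).factorial : ℝ))‖ ≤ r ^ n / n.factorial := by
  have h0 : 0 ≤ r := (abs_nonneg z).trans h
  have h1 : (1 : ℝ) ≤ ((n + 1).factorial : ℝ) := by
    exact_mod_cast Nat.succ_le_of_lt (Nat.factorial_pos (n + 1))
  have h2 : (0 : ℝ) < (n.factorial : ℝ) := by exact_mod_cast Nat.factorial_pos n
  rw [Real.norm_eq_abs, abs_div, abs_pow, abs_of_pos (mul_pos h2 (by linarith))]
  gcongr
  nlinarith

theorem summable_besselSeries (z : ℝ) :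
    Summable fun n : ℕ => z ^ n / ((n.factorial : ℝ) * ((n + 1).factorial : ℝ)) :=
  (Real.summable_pow_div_factorial |z|).of_norm_bounded fun n =>
    abs_besselSeries_term_le le_rfl n

theorem continuous_besselSeries : Continuous besselSeries := by
  rw [continuous_iff_continuousAt]
  intro z
  have h : ContinuousOn besselSeries (Metric.closedBall 0 (|z| + 1)) :=
    continuousOn_tsum (fun n => by fun_prop) (Real.summable_pow_div_factorial (|z| + 1))
      fun n w hw => abs_besselSeries_term_le (by simpa using hw) n
  exact h.continuousAt (Metric.closedBall_mem_nhds_of_mem (by simp))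

theorem integral_pow_div_factorial_mul (t : ℝ) (n m : ℕ) :
    ∫ a in (0 : ℝ)..t, a ^ n / n.factorial * ((t - a) ^ m / m.factorial) =
      t ^ (n + m + 1) / (n + m + 1).factorial := by
  have hd : ∀ (k : ℕ) (x : ℝ),
      HasDerivAt (fun x : ℝ => x ^ (k + 1) / (k + 1).factorial) (x ^ k / k.factorial) x := by
    intro k x
    convert! (hasDerivAt_pow (k + 1) x).div_const ((k + 1).factorial : ℝ) using 1
    rw [Nat.factorial_succ]
    have : (k.factorial : ℝ) ≠ 0 := by positivity
    push_cast
    field_simp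
  have hr : ∀ (k : ℕ) (x : ℝ), HasDerivAt (fun x : ℝ => (t - x) ^ (k + 1) / (k + 1).factorial)
      (-((t - x) ^ k / k.factorial)) x := by
    intro k x
    have := (hd k (t - x)).comp x ((hasDerivAt_id x).const_sub t)
    simpa [Function.comp_def] using! this
  induction n generalizing m with
  | zero =>
    have := integral_eq_sub_of_hasDerivAt (a := 0) (b := t) (fun x _ => (hr m x).neg)
      (by apply Continuous.intervalIntegrable; fun_prop)
    simpa using this
  | succ n ih =>
    have := integral_eq_sub_of_hasDerivAt (a := 0) (b := t)
      (fun x _ => (hd n x).mul (hr m x))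
      (by apply Continuous.intervalIntegrable; fun_prop)
    rw [intervalIntegral.integral_add (by apply Continuous.intervalIntegrable; fun_prop)
      (by apply Continuous.intervalIntegrable; fun_prop), ih] at this
    simp only [mul_neg, intervalIntegral.integral_neg] at this
    have e : n + 1 + m + 1 = n + (m + 1) + 1 := by omega
    rw [e]
    simp at this ⊢
    linarith

theorem sum_antidiagonal_neg_one_pow_div_factorial_succ (k : ℕ) :
    ∑ p ∈ Finset.HasAntidiagonal.antidiagonal k,
      (-1 : ℝ) ^ p.1 / (((p.1 + 1).factorial : ℝ) * ((p.2 + 1).factorial : ℝ)) =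
      (1 + (-1) ^ k) / (k + 2).factorial := by
  have h : ∑ p ∈ Finset.HasAntidiagonal.antidiagonal (k + 2),
      (-1 : ℝ) ^ p.1 / ((p.1.factorial : ℝ) * (p.2.factorial : ℝ)) = 0 := by
    have h1 := (Commute.all (-1 : ℝ) 1).add_pow' (k + 2)
    have h2 : ∀ p ∈ Finset.HasAntidiagonal.antidiagonal (k + 2),
        (-1 : ℝ) ^ p.1 / ((p.1.factorial : ℝ) * (p.2.factorial : ℝ)) =
        ((k + 2).choose p.1 • ((-1 : ℝ) ^ p.1 * 1 ^ p.2)) / (k + 2).factorial := by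
      intro p hp
      rw [Finset.HasAntidiagonal.mem_antidiagonal] at hp
      rw [← hp, ← Nat.add_choose_mul_factorial_mul_factorial p.1 p.2, ← Nat.choose_symm_add]
      have : ((p.1 + p.2).choose p.1 : ℝ) ≠ 0 := by
        exact_mod_cast (Nat.choose_pos (Nat.le_add_right _ _)).ne'
      have := Nat.factorial_ne_zero p.1
      have := Nat.factorial_ne_zero p.2
      push_cast
      simp only [nsmul_eq_mul, one_pow, mul_one]
      field_simp
    rw [Finset.sum_congr rfl h2, ← Finset.sum_div, ← h1]
    simp
  rw [Finset.Nat.antidiagonal_succ_succ'] at h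
  simp only [Finset.sum_cons, Finset.sum_map, Function.Embedding.coe_prodMap,
    Function.Embedding.coeFn_mk, Prod.map, Nat.succ_eq_add_one, pow_succ, mul_neg, mul_one, neg_neg,
    neg_div, Finset.sum_neg_distrib, Nat.factorial_zero, Nat.cast_one, one_mul, pow_zero] at h
  rw [add_div]
  linarith

theorem sum_antidiagonal_besselSeries_convolution (t : ℝ) (k : ℕ) :
    ∑ p ∈ Finset.HasAntidiagonal.antidiagonal k,
      (-1 : ℝ) ^ p.1 / (((p.1 + 1).factorial : ℝ) * ((p.2 + 1).factorial : ℝ)) *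
        (t ^ (p.1 + p.2 + 1) / (p.1 + p.2 + 1).factorial) =
      t ^ (k + 1) / (((k + 1).factorial : ℝ) * ((k + 1 + 1).factorial : ℝ)) -
      (-t) ^ (k + 1) / (((k + 1).factorial : ℝ) * ((k + 1 + 1).factorial : ℝ)) := by
  have : ∀ p ∈ Finset.HasAntidiagonal.antidiagonal k,
      (-1 : ℝ) ^ p.1 / (((p.1 + 1).factorial : ℝ) * ((p.2 + 1).factorial : ℝ)) *
      (t ^ (p.1 + p.2 + 1) / (p.1 + p.2 + 1).factorial) =
      (-1 : ℝ) ^ p.1 / (((p.1 + 1).factorial : ℝ) * ((p.2 + 1).factorial : ℝ)) *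
      (t ^ (k + 1) / (k + 1).factorial) := by
    intro p hp
    rw [Finset.HasAntidiagonal.mem_antidiagonal.mp hp]
  rw [Finset.sum_congr rfl this, ← Finset.sum_mul,
    sum_antidiagonal_neg_one_pow_div_factorial_succ, neg_pow t (k + 1)]
  field_simp
  ring

theorem HasSum.sum_antidiagonal {u : ℕ × ℕ → ℝ} {a : ℝ} (h : HasSum u a) :
    HasSum (fun k => ∑ p ∈ Finset.HasAntidiagonal.antidiagonal k, u p) a := by
  rw [← Finset.HasAntidiagonal.sigmaAntidiagonalEquivProd.hasSum_iff] at h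
  refine h.sigma fun k => ?_
  rw [← Finset.sum_coe_sort]
  exact hasSum_fintype _

theorem hasSum_mul_of_summable {u v : ℕ → ℝ} (hu : Summable u) (hv : Summable v) :
    HasSum (fun p : ℕ × ℕ => u p.1 * v p.2) ((∑' n, u n) * ∑' n, v n) :=
  hu.hasSum.mul hv.hasSum (summable_mul_of_summable_norm hu.norm hv.norm)

theorem hasSum_besselSeries_mul (z w : ℝ) :
    HasSum (fun p : ℕ × ℕ =>
      (z ^ p.1 / ((p.1.factorial : ℝ) * ((p.1 + 1).factorial : ℝ))) *
      (w ^ p.2 / ((p.2.factorial : ℝ) * ((p.2 + 1).factorial : ℝ))))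
      (besselSeries z * besselSeries w) :=
  hasSum_mul_of_summable (summable_besselSeries z) (summable_besselSeries w)

theorem hasSum_besselSeries_sub_neg (t : ℝ) :
    HasSum (fun k : ℕ =>
      t ^ (k + 1) / (((k + 1).factorial : ℝ) * ((k + 1 + 1).factorial : ℝ)) -
      (-t) ^ (k + 1) / (((k + 1).factorial : ℝ) * ((k + 1 + 1).factorial : ℝ)))
      (besselSeries t - besselSeries (-t)) := by
  have h := (summable_besselSeries t).hasSum.sub (summable_besselSeries (-t)).hasSum
  rw [← hasSum_nat_add_iff' 1] at h
  simp only [Finset.range_one, Finset.sum_singleton, pow_zero, sub_self, sub_zero] at h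
  exact h

/-- The convolution identity behind the reciprocity: in terms of Laplace transforms it reads
`(1 - e^{-1/p}) (e^{1/p} - 1) = (e^{1/p} - 1) - (1 - e^{-1/p})`. -/
theorem integral_besselSeries_neg_mul_besselSeries_sub (t : ℝ) :
    ∫ a in (0 : ℝ)..t, besselSeries (-a) * besselSeries (t - a) =
      besselSeries t - besselSeries (-t) := by
  have hb := (Real.summable_pow_div_factorial |t|)
  have hbp : Summable fun p : ℕ × ℕ =>
      (|t| ^ p.1 / (p.1.factorial : ℝ)) * (|t| ^ p.2 / (p.2.factorial : ℝ)) :=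
    hb.mul_of_nonneg hb (fun n => by positivity) (fun n => by positivity)
  have hab : ∀ a ∈ uIoc 0 t, |(-a)| ≤ |t| ∧ |t - a| ≤ |t| := by
    intro a ha
    rw [abs_neg]
    rcases le_total 0 t with h | h
    · rw [uIoc_of_le h] at ha
      rw [abs_of_nonneg h, abs_of_pos ha.1, abs_of_nonneg (by linarith [ha.2])]
      exact ⟨ha.2, by linarith [ha.1]⟩
    · rw [uIoc_of_ge h] at ha
      rw [abs_of_nonpos h, abs_of_nonpos ha.2, abs_of_nonpos (by linarith [ha.1])]
      exact ⟨by linarith [ha.1], by linarith [ha.2]⟩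
  have key := intervalIntegral.hasSum_integral_of_dominated_convergence (μ := volume) (a := 0) (b := t)
    (F := fun (p : ℕ × ℕ) (a : ℝ) =>
      ((-a) ^ p.1 / ((p.1.factorial : ℝ) * ((p.1 + 1).factorial : ℝ))) *
      ((t - a) ^ p.2 / ((p.2.factorial : ℝ) * ((p.2 + 1).factorial : ℝ))))
    (f := fun a => besselSeries (-a) * besselSeries (t - a))
    (fun p _ => (|t| ^ p.1 / (p.1.factorial : ℝ)) * (|t| ^ p.2 / (p.2.factorial : ℝ)))
    (fun p => by
      apply Continuous.aestronglyMeasurable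
      fun_prop)
    (fun p => ae_of_all _ fun a ha => by
      rw [norm_mul]
      exact mul_le_mul (abs_besselSeries_term_le (hab a ha).1 _)
        (abs_besselSeries_term_le (hab a ha).2 _) (norm_nonneg _) (by positivity))
    (ae_of_all _ fun a _ => hbp)
    intervalIntegrable_const
    (ae_of_all _ fun a _ => hasSum_besselSeries_mul (-a) (t - a))
  have hterm : ∀ p : ℕ × ℕ, ∫ a in (0 : ℝ)..t,
      ((-a) ^ p.1 / ((p.1.factorial : ℝ) * ((p.1 + 1).factorial : ℝ))) *
      ((t - a) ^ p.2 / ((p.2.factorial : ℝ) * ((p.2 + 1).factorial : ℝ))) =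
      (-1 : ℝ) ^ p.1 / (((p.1 + 1).factorial : ℝ) * ((p.2 + 1).factorial : ℝ)) *
        (t ^ (p.1 + p.2 + 1) / (p.1 + p.2 + 1).factorial) := by
    intro p
    rw [← integral_pow_div_factorial_mul, ← intervalIntegral.integral_const_mul]
    congr 1
    ext a
    rw [neg_pow]
    field_simp
  simp only [hterm] at key
  have hsum := key.sum_antidiagonal
  simp only [sum_antidiagonal_besselSeries_convolution] at hsum
  exact hsum.unique (hasSum_besselSeries_sub_neg t)

/-- Interchange of the order of integration over the triangle `a ≤ y ≤ z ≤ b`. -/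
theorem integral_integral_swap_triangle {G : ℝ → ℝ → ℝ} (hG : Continuous (Function.uncurry G))
    {a b : ℝ} (hab : a ≤ b) :
    ∫ y in a..b, ∫ z in y..b, G y z = ∫ z in a..b, ∫ y in a..z, G y z := by
  have hS : MeasurableSet {p : ℝ × ℝ | p.1 < p.2} := measurableSet_lt measurable_fst measurable_snd
  let F : ℝ → ℝ → ℝ := fun y z => {p : ℝ × ℝ | p.1 < p.2}.indicator (Function.uncurry G) (y, z)
  have hF : IntegrableOn (Function.uncurry F) (uIoc a b ×ˢ uIoc a b) := by
    have h1 : IntegrableOn (Function.uncurry G) (uIoc a b ×ˢ uIoc a b) :=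
      (hG.continuousOn.integrableOn_compact (isCompact_Icc.prod isCompact_Icc)).mono_set
        (prod_mono (uIoc_subset_uIcc) (uIoc_subset_uIcc))
    exact h1.indicator hS
  have hswap := intervalIntegral_intervalIntegral_swap hF
  have hl : ∫ y in a..b, ∫ z in a..b, F y z = ∫ y in a..b, ∫ z in y..b, G y z := by
    refine integral_congr fun y hy => ?_
    rw [uIcc_of_le hab] at hy
    have : F y = (Ioi y).indicator (G y) := by
      ext z
      simp [F, indicator_apply]
    simp only [this]
    rw [integral_of_le hab, integral_of_le hy.2, setIntegral_indicator measurableSet_Ioi]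
    congr 2
    ext z
    simp only [mem_inter_iff, mem_Ioc, mem_Ioi]
    exact ⟨fun h => ⟨h.2, h.1.2⟩, fun h => ⟨⟨hy.1.trans_lt h.1, h.2⟩, h.1⟩⟩
  have hr : ∫ z in a..b, ∫ y in a..b, F y z = ∫ z in a..b, ∫ y in a..z, G y z := by
    refine integral_congr fun z hz => ?_
    rw [uIcc_of_le hab] at hz
    have : (fun y => F y z) = (Iio z).indicator (fun y => G y z) := by
      ext y
      simp [F, indicator_apply]
    simp only [this]
    rw [integral_of_le hab, integral_of_le hz.1, setIntegral_indicator measurableSet_Iio,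
      integral_Ioc_eq_integral_Ioo]
    congr 2
    ext y
    simp only [mem_inter_iff, mem_Ioc, mem_Iio, mem_Ioo]
    exact ⟨fun h => ⟨h.1.1, h.2⟩, fun h => ⟨⟨h.1, h.2.le.trans hz.2⟩, h.2⟩⟩
  rw [← hl, ← hr, hswap]

theorem PKernel_eq (α lam x y : ℝ) :
    PKernel α lam x y =
      (lam * y / (2 * α)) * besselSeries (lam * (y ^ 2 - x ^ 2) / (4 * α)) := rfl

theorem QKernel_eq (α lam x y : ℝ) :
    QKernel α lam x y =
      (lam * y / (2 * α)) * besselSeries (-(lam * (y ^ 2 - x ^ 2) / (4 * α))) := by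
  simp only [QKernel, besselSeries, neg_pow (lam * (y ^ 2 - x ^ 2) / (4 * α))]

theorem continuous_PKernel (α lam : ℝ) : Continuous (Function.uncurry (PKernel α lam)) := by
  have := continuous_besselSeries
  simp only [Function.uncurry_def, PKernel_eq]
  fun_prop

theorem continuous_QKernel (α lam : ℝ) : Continuous (Function.uncurry (QKernel α lam)) := by
  have := continuous_besselSeries
  simp only [Function.uncurry_def, QKernel_eq]
  fun_prop

/-- The resolvent identity for the pair of Volterra kernels. -/
theorem integral_QKernel_mul_PKernel (α lam x z : ℝ) :
    ∫ y in x..z, QKernel α lam x y * PKernel α lam y z =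
      PKernel α lam x z - QKernel α lam x z := by
  have hB := continuous_besselSeries
  set t := lam * (z ^ 2 - x ^ 2) / (4 * α) with ht
  have hcv := integral_comp_mul_deriv (a := x) (b := z)
    (f := fun y => lam * (y ^ 2 - x ^ 2) / (4 * α)) (f' := fun y => lam * y / (2 * α))
    (g := fun a => besselSeries (-a) * besselSeries (t - a))
    (fun y _ => by
      convert! ((((hasDerivAt_pow 2 y).sub_const (x ^ 2)).const_mul lam).div_const (4 * α)) using 1
      simp only [Nat.cast_ofNat, Nat.add_one_sub_one, pow_one]
      rw [show lam * (2 * y) = 2 * (lam * y) by ring, show 4 * α = 2 * (2 * α) by ring,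
        mul_div_mul_left _ _ two_ne_zero])
    (by fun_prop) (by fun_prop)
  simp only [sub_self, mul_zero, zero_div, ← ht,
    integral_besselSeries_neg_mul_besselSeries_sub] at hcv
  rw [PKernel_eq, QKernel_eq, ← ht, ← mul_sub, ← hcv, ← intervalIntegral.integral_const_mul]
  refine integral_congr fun y _ => ?_
  have : t - lam * (y ^ 2 - x ^ 2) / (4 * α) = lam * (z ^ 2 - y ^ 2) / (4 * α) := by
    rw [ht]; ring
  simp only [Function.comp_apply, this, PKernel_eq, QKernel_eq]
  ring

theorem integral_QKernel_mul_add_integral_PKernel (α lam : ℝ) {x s : ℝ} (hx : x ≤ s)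
    {f : ℝ → ℝ} (hf : Continuous f) :
    ∫ y in x..s, QKernel α lam x y * (f y + ∫ z in y..s, PKernel α lam y z * f z) =
      ∫ y in x..s, PKernel α lam x y * f y := by
  have hP := continuous_PKernel α lam
  have hQ := continuous_QKernel α lam
  have hQx : Continuous (QKernel α lam x) := hQ.comp (by fun_prop : Continuous fun y => (x, y))
  have hPx : Continuous (PKernel α lam x) := hP.comp (by fun_prop : Continuous fun y => (x, y))
  have hPf : Continuous (Function.uncurry fun y z => PKernel α lam y z * f z) := by
    simp only [Function.uncurry_def] at hP ⊢
    fun_prop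
  have hI : Continuous fun y => ∫ z in y..s, PKernel α lam y z * f z := by
    simp_rw [integral_symm s]
    exact (continuous_parametric_intervalIntegral_of_continuous hPf continuous_id).neg
  have hG : Continuous (Function.uncurry fun y z =>
      QKernel α lam x y * (PKernel α lam y z * f z)) := by
    simp only [Function.uncurry_def] at hPf ⊢
    fun_prop
  simp only [mul_add]
  rw [intervalIntegral.integral_add (Continuous.intervalIntegrable (by fun_prop) _ _)
    (Continuous.intervalIntegrable (by fun_prop) _ _)]
  simp only [← intervalIntegral.integral_const_mul]
  rw [integral_integral_swap_triangle hG hx]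
  simp only [← mul_assoc, intervalIntegral.integral_mul_const, integral_QKernel_mul_PKernel]
  rw [← intervalIntegral.integral_add (Continuous.intervalIntegrable (by fun_prop) _ _)
    (Continuous.intervalIntegrable (by fun_prop) _ _)]
  refine integral_congr fun y _ => ?_
  ring

/-- **Reciprocity of the backstepping kernels.** For every continuous `f` on `[0,s]`,
if `g(x) = f(x) + ∫_x^s P(x,y) f(y) dy`, then `f(x) = g(x) − ∫_x^s Q(x,y) g(y) dy` on
`[0,s]`: the Volterra transformation with kernel `Q` inverts the one with kernel `P`. -/
theorem backstepping_kernel_reciprocity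
    (α lam s : ℝ) (hα : 0 < α) (hlam : 0 < lam) (hs : 0 < s)
    (f g : ℝ → ℝ) (hf : ContinuousOn f (Set.Icc 0 s))
    (hg : ∀ x ∈ Set.Icc 0 s, g x = f x + ∫ y in x..s, PKernel α lam x y * f y) :
    ∀ x ∈ Set.Icc 0 s, f x = g x - ∫ y in x..s, QKernel α lam x y * g y := by
  intro x hx
  let F : ℝ → ℝ := IccExtend hs.le ((Icc 0 s).domRestrict f)
  have hF : Continuous F := hf.domRestrict.Icc_extend'
  have hFf : ∀ y ∈ Icc 0 s, F y = f y := fun y hy => by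
    simp [F, IccExtend_of_mem hs.le _ hy, domRestrict_apply]
  have hPF : ∀ y ∈ Icc 0 s, ∫ z in y..s, PKernel α lam y z * F z =
      ∫ z in y..s, PKernel α lam y z * f z := fun y hy => by
    refine integral_congr fun z hz => ?_
    rw [uIcc_of_le hy.2] at hz
    simp only [hFf z ⟨hy.1.trans hz.1, hz.2⟩]
  have hQg : ∫ y in x..s, QKernel α lam x y * g y =
      ∫ y in x..s, QKernel α lam x y * (F y + ∫ z in y..s, PKernel α lam y z * F z) := by
    refine integral_congr fun y hy => ?_
    rw [uIcc_of_le hx.2] at hy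
    have hy0 : y ∈ Icc 0 s := ⟨hx.1.trans hy.1, hy.2⟩
    simp only [hg y hy0, hPF y hy0, hFf y hy0]
  rw [hQg, integral_QKernel_mul_add_integral_PKernel α lam hx.2 hF, hPF x hx, hg x hx]
  ring
end

section
/- (Sufficiency of the gain restriction for initial negativity of the transformed error.) Let α > 0, s₀ > 0, 0 < H < Ĥ, and 0 < λ < (4α/s₀²)(1 − H/Ĥ). Let ũ₀ : [0, s₀] → ℝ be continuous with ũ₀(x) = (T₀(x) − T_m) − Ĥ(s₀ − x) where 0 ≤ T₀(x) − T_m ≤ H(s₀ − x), so that (H − Ĥ)(s₀ − x) ≥ ũ₀(x) ≥ −Ĥ(s₀ − x) and ũ₀(x) < 0 on (0, s₀). Then ũ₀(x) < ∫_x^{s₀} Q(x,y) ũ₀(y) dy for all x ∈ (0, s₀), where Q(x,y) = (λ y/(2α)) Σ_{n=0}^∞ (−1)^n (λ(y² − x²)/(4α))^n/(n!(n+1)!); equivalently, the transformed initial error w̃(x,0) = ũ₀(x) − ∫_x^{s₀} Q(x,y) ũ₀(y) dy is strictly negative on (0, s₀). -/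
open intervalIntegral

lemma antitone_pow_div_factorial_mul_factorial {t : ℝ} (h0 : 0 ≤ t) (h1 : t ≤ 1) :
    Antitone fun n : ℕ => t ^ n / ((n.factorial : ℝ) * ((n + 1).factorial : ℝ)) := by
  intro m n hmn
  have hm : (m.factorial : ℝ) ≤ n.factorial := by exact_mod_cast Nat.factorial_le hmn
  have hm' : ((m + 1).factorial : ℝ) ≤ (n + 1).factorial := by
    exact_mod_cast Nat.factorial_le (Nat.add_le_add_right hmn 1)
  have hpow : t ^ n ≤ t ^ m := pow_le_pow_of_le_one h0 h1 hmn
  dsimp only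
  gcongr

lemma norm_besselTerm_le {t : ℝ} (ht : |t| ≤ 1) (n : ℕ) :
    ‖(-1) ^ n * t ^ n / ((n.factorial : ℝ) * ((n + 1).factorial : ℝ))‖
      ≤ 1 ^ n / (n.factorial : ℝ) := by
  have hn : (0 : ℝ) < n.factorial := by exact_mod_cast n.factorial_pos
  have hn' : (1 : ℝ) ≤ (n + 1).factorial := by exact_mod_cast (n + 1).factorial_pos
  have hpow : |t| ^ n ≤ 1 ^ n := pow_le_pow_left₀ (abs_nonneg t) ht n
  rw [norm_div, norm_mul, norm_pow, norm_neg, norm_one, one_pow, one_mul, norm_pow,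
    Real.norm_eq_abs, Real.norm_of_nonneg (by positivity)]
  rw [one_pow] at hpow
  gcongr
  exact le_mul_of_one_le_right hn.le hn'

lemma besselSeries_mem_Icc {t : ℝ} (h0 : 0 ≤ t) (h1 : t ≤ 1) :
    ∑' n : ℕ, (-1) ^ n * t ^ n / ((n.factorial : ℝ) * ((n + 1).factorial : ℝ))
      ∈ Set.Icc (0 : ℝ) 1 := by
  have hsum : Summable fun n : ℕ =>
      (-1) ^ n * t ^ n / ((n.factorial : ℝ) * ((n + 1).factorial : ℝ)) :=
    .of_norm_bounded (Real.summable_pow_div_factorial 1)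
      (norm_besselTerm_le (abs_le.2 ⟨by linarith, h1⟩))
  have hanti := antitone_pow_div_factorial_mul_factorial h0 h1
  have hlim := hsum.hasSum.tendsto_sum_nat
  simp only [mul_div_assoc] at hlim ⊢
  constructor
  · simpa using hanti.alternating_series_le_tendsto hlim 0
  · simpa using hanti.tendsto_le_alternating_series hlim 0

lemma scaled_sq_sub_sq_mem_Icc {α lam s₀ x y : ℝ} (hα : 0 < α) (hlam : 0 ≤ lam)
    (hs : lam * s₀ ^ 2 ≤ 4 * α) (hx : 0 ≤ x) (hy : y ∈ Set.Icc x s₀) :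
    lam * (y ^ 2 - x ^ 2) / (4 * α) ∈ Set.Icc (0 : ℝ) 1 := by
  obtain ⟨hxy, hys⟩ := hy
  have hsq : x ^ 2 ≤ y ^ 2 := pow_le_pow_left₀ hx hxy 2
  have hsq' : y ^ 2 ≤ s₀ ^ 2 := pow_le_pow_left₀ (hx.trans hxy) hys 2
  refine ⟨div_nonneg (mul_nonneg hlam (by linarith)) (by positivity), ?_⟩
  rw [div_le_one (by positivity)]
  exact (mul_le_mul_of_nonneg_left (by nlinarith [sq_nonneg x]) hlam).trans hs

lemma QKernel_mem_Icc {α lam s₀ x y : ℝ} (hα : 0 < α) (hlam : 0 ≤ lam)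
    (hs : lam * s₀ ^ 2 ≤ 4 * α) (hx : 0 ≤ x) (hy : y ∈ Set.Icc x s₀) :
    QKernel α lam x y ∈ Set.Icc 0 (lam * y / (2 * α)) := by
  obtain ⟨h0, h1⟩ := scaled_sq_sub_sq_mem_Icc hα hlam hs hx hy
  obtain ⟨hS0, hS1⟩ := besselSeries_mem_Icc h0 h1
  have hy0 : 0 ≤ y := hx.trans hy.1
  have hc : 0 ≤ lam * y / (2 * α) := by positivity
  exact ⟨mul_nonneg hc hS0, mul_le_of_le_one_right hc hS1⟩

lemma continuousOn_QKernel {α lam s₀ x : ℝ} (hα : 0 < α) (hlam : 0 ≤ lam)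
    (hs : lam * s₀ ^ 2 ≤ 4 * α) (hx : 0 ≤ x) :
    ContinuousOn (QKernel α lam x) (Set.Icc x s₀) := by
  refine ContinuousOn.mul (by fun_prop) (continuousOn_tsum (fun n => by fun_prop)
    (Real.summable_pow_div_factorial 1) fun n y hy => norm_besselTerm_le ?_ n)
  obtain ⟨h0, h1⟩ := scaled_sq_sub_sq_mem_Icc hα hlam hs hx hy
  exact abs_le.2 ⟨by linarith, h1⟩

/-- **Sufficiency of the gain restriction for initial negativity of the transformed
error.** Let `0 < λ < (4α/s₀²)(1 − H/Ĥ)` with `0 < H < Ĥ`, and let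
`ũ₀(x) = (T₀(x) − T_m) − Ĥ(s₀ − x)` where `0 ≤ T₀(x) − T_m ≤ H(s₀ − x)`. Then
`ũ₀(x) < ∫_x^{s₀} Q(x,y) ũ₀(y) dy` on `(0, s₀)`, i.e. the transformed initial error
`w̃(x,0) = ũ₀(x) − ∫_x^{s₀} Q(x,y) ũ₀(y) dy` is strictly negative on `(0, s₀)`. -/
theorem gain_restriction_initial_negativity
    (α s₀ H Hhat lam Tm : ℝ)
    (hα : 0 < α) (hs₀ : 0 < s₀) (hH : 0 < H) (hHhat : H < Hhat)
    (hlam : 0 < lam) (hlamBound : lam < (4 * α / s₀^2) * (1 - H / Hhat))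
    (T₀ : ℝ → ℝ) (hT₀ : ContinuousOn T₀ (Set.Icc 0 s₀))
    (hT₀bound : ∀ x ∈ Set.Icc 0 s₀, 0 ≤ T₀ x - Tm ∧ T₀ x - Tm ≤ H * (s₀ - x)) :
    ∀ x ∈ Set.Ioo 0 s₀,
      ((T₀ x - Tm) - Hhat * (s₀ - x)) <
        ∫ y in x..s₀, QKernel α lam x y * ((T₀ y - Tm) - Hhat * (s₀ - y)) := by
  rintro x ⟨hx0, hxs⟩
  have hHhat0 : 0 < Hhat := hH.trans hHhat
  have hgain : lam * s₀ ^ 2 * Hhat < 4 * α * (Hhat - H) := by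
    have h := mul_lt_mul_of_pos_right hlamBound (show 0 < s₀ ^ 2 * Hhat by positivity)
    have e : 4 * α / s₀ ^ 2 * (1 - H / Hhat) * (s₀ ^ 2 * Hhat) = 4 * α * (Hhat - H) := by
      field_simp
    linarith
  have hs : lam * s₀ ^ 2 ≤ 4 * α := by
    refine le_of_mul_le_mul_right ?_ hHhat0
    nlinarith [mul_pos hα hH]
  have hsub : Set.Icc x s₀ ⊆ Set.Icc 0 s₀ := Set.Icc_subset_Icc_left hx0.le
  have hint : IntervalIntegrable
      (fun y => QKernel α lam x y * ((T₀ y - Tm) - Hhat * (s₀ - y)))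
      MeasureTheory.volume x s₀ := by
    refine ContinuousOn.intervalIntegrable_of_Icc hxs.le ?_
    refine (continuousOn_QKernel hα hlam.le hs hx0.le).mul ?_
    exact ((hT₀.mono hsub).sub continuousOn_const).sub (by fun_prop)
  have hlower : ∀ y ∈ Set.Icc x s₀, -(lam * Hhat * (s₀ - x) / (2 * α)) * y ≤
      QKernel α lam x y * ((T₀ y - Tm) - Hhat * (s₀ - y)) := by
    intro y hy
    obtain ⟨hQ0, hQ1⟩ := QKernel_mem_Icc hα hlam.le hs hx0.le hy
    have hu : -(Hhat * (s₀ - x)) ≤ (T₀ y - Tm) - Hhat * (s₀ - y) := by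
      nlinarith [(hT₀bound y (hsub hy)).1, hy.1]
    have hb : 0 ≤ Hhat * (s₀ - x) := mul_nonneg hHhat0.le (by linarith)
    calc -(lam * Hhat * (s₀ - x) / (2 * α)) * y
        = -(lam * y / (2 * α) * (Hhat * (s₀ - x))) := by ring
      _ ≤ -(QKernel α lam x y * (Hhat * (s₀ - x))) :=
          neg_le_neg (mul_le_mul_of_nonneg_right hQ1 hb)
      _ = QKernel α lam x y * -(Hhat * (s₀ - x)) := by ring
      _ ≤ _ := mul_le_mul_of_nonneg_left hu hQ0
  have hmono := integral_mono_on hxs.le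
    (Continuous.intervalIntegrable (by fun_prop) x s₀) hint hlower
  rw [intervalIntegral.integral_const_mul, integral_id] at hmono
  refine lt_of_lt_of_le ?_ hmono
  have hx := (hT₀bound x ⟨hx0.le, hxs.le⟩).2
  have hpos : 0 < s₀ - x := by linarith
  have hcoef : lam * Hhat * (s₀ ^ 2 - x ^ 2) / (4 * α) < Hhat - H := by
    rw [div_lt_iff₀ (by positivity)]
    nlinarith [show 0 ≤ lam * Hhat * x ^ 2 by positivity]
  have hmul := mul_lt_mul_of_pos_right hcoef hpos
  calc (T₀ x - Tm) - Hhat * (s₀ - x) ≤ -((Hhat - H) * (s₀ - x)) := by linarith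
    _ < -(lam * Hhat * (s₀ ^ 2 - x ^ 2) / (4 * α) * (s₀ - x)) := neg_lt_neg hmul
    _ = _ := by ring
end

section
/- (Inverse transformation for the controller backstepping.) Let c > 0, α > 0, β > 0, s > 0, X ∈ ℝ, and let ψ(x) = (c/β)√(α/c) sin(√(c/α) x). For any continuous functions û and ŵ on [0, s] related by ŵ(x) = û(x) − (c/α) ∫_x^{s} (x − y) û(y) dy + (c/β)(s − x) X, the inverse relation û(x) = ŵ(x) + (β/α) ∫_x^{s} ψ(x − y) ŵ(y) dy + ψ(x − s) X holds for all x ∈ [0, s]. -/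
open intervalIntegral

/-- `ψ(x) = (c/β)√(α/c) sin(√(c/α) x)`, which solves `ψ'' = −(c/α)ψ`, `ψ(0) = 0`,
`ψ'(0) = c/β`. -/
noncomputable def psiKer (c α β x : ℝ) : ℝ :=
  (c / β) * Real.sqrt (α / c) * Real.sin (Real.sqrt (c / α) * x)

theorem sqrt_div_mul_sqrt_div {c α : ℝ} (hc : 0 < c) (hα : 0 < α) :
    Real.sqrt (α / c) * Real.sqrt (c / α) = 1 := by
  rw [← Real.sqrt_mul (by positivity), div_mul_div_cancel₀ hc.ne', div_self hα.ne',
    Real.sqrt_one]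

theorem hasDerivAt_psiKer_sub (c α β x y : ℝ) (hc : 0 < c) (hα : 0 < α) :
    HasDerivAt (fun y => psiKer c α β (x - y))
      (-((c / β) * Real.cos (Real.sqrt (c / α) * (x - y)))) y := by
  have hprod := sqrt_div_mul_sqrt_div hc hα
  have h := ((((hasDerivAt_id' y).const_sub x).const_mul (Real.sqrt (c / α))).sin).const_mul
    ((c / β) * Real.sqrt (α / c))
  refine h.congr_deriv ?_
  linear_combination (-(c / β) * Real.cos (Real.sqrt (c / α) * (x - y))) * hprod

theorem hasDerivAt_cos_sub (c α β x y : ℝ) (hc : 0 < c) (hα : 0 < α) :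
    HasDerivAt (fun y => (c / β) * Real.cos (Real.sqrt (c / α) * (x - y)))
      ((c / α) * psiKer c α β (x - y)) y := by
  have hprod := sqrt_div_mul_sqrt_div hc hα
  have hsq : Real.sqrt (c / α) * Real.sqrt (c / α) = c / α :=
    Real.mul_self_sqrt (by positivity)
  have h := ((((hasDerivAt_id' y).const_sub x).const_mul (Real.sqrt (c / α))).cos).const_mul
    (c / β)
  refine h.congr_deriv ?_
  unfold psiKer
  linear_combination
    (-(c / β) * Real.sqrt (c / α) * Real.sin (Real.sqrt (c / α) * (x - y))) * hprod +
    ((c / β) * Real.sin (Real.sqrt (c / α) * (x - y)) * Real.sqrt (α / c)) * hsq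

theorem hasDerivAt_integral_lower {f : ℝ → ℝ} (hf : Continuous f) (s x : ℝ) :
    HasDerivAt (fun x => ∫ y in x..s, f y) (-f x) x :=
  integral_hasDerivAt_left (hf.intervalIntegrable _ _)
    hf.stronglyMeasurable.stronglyMeasurableAtFilter hf.continuousAt

theorem hasDerivAt_integral_sub_mul {f : ℝ → ℝ} (hf : Continuous f) (s x : ℝ) :
    HasDerivAt (fun x => ∫ y in x..s, (x - y) * f y) (∫ y in x..s, f y) x := by
  have hsplit : (fun x => ∫ y in x..s, (x - y) * f y) =
      fun x => x * (∫ y in x..s, f y) - ∫ y in x..s, y * f y := by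
    funext x
    rw [← integral_const_mul, ← integral_sub]
    · simp only [sub_mul]
    · exact (continuous_const.mul hf).intervalIntegrable _ _
    · exact (continuous_id.mul hf).intervalIntegrable _ _
  rw [hsplit]
  refine (((hasDerivAt_id' x).mul (hasDerivAt_integral_lower hf s x)).sub
    (hasDerivAt_integral_lower (continuous_id.mul hf) s x)).congr_deriv ?_
  simp

/-- Variation of constants for `g'' + (c/α) g = -(c/α) w` with terminal data at `s`, where
`g = u - w` and `w` is the direct transform of `u`. -/
theorem integral_psiKer_mul_direct (c α β s X : ℝ) (hc : 0 < c) (hα : 0 < α)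
    {u : ℝ → ℝ} (hu : Continuous u) (x : ℝ) :
    -(c / α) * (∫ y in x..s, psiKer c α β (x - y) *
        (u y - (c / α) * (∫ z in y..s, (y - z) * u z) + (c / β) * (s - y) * X)) =
      psiKer c α β (x - s) * ((c / β) * X) -
        (c / β) * ((c / α) * (∫ z in x..s, (x - z) * u z) - (c / β) * (s - x) * X) := by
  have hψ : Continuous fun y => psiKer c α β (x - y) :=
    continuous_iff_continuousAt.2 fun y => (hasDerivAt_psiKer_sub c α β x y hc hα).continuousAt
  have hI : Continuous fun y => ∫ z in y..s, (y - z) * u z :=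
    continuous_iff_continuousAt.2 fun y => (hasDerivAt_integral_sub_mul hu s y).continuousAt
  have hderiv : ∀ y, HasDerivAt
      (fun y => psiKer c α β (x - y) * ((c / α) * (∫ z in y..s, u z) + (c / β) * X) +
        (c / β) * Real.cos (Real.sqrt (c / α) * (x - y)) *
          ((c / α) * (∫ z in y..s, (y - z) * u z) - (c / β) * (s - y) * X))
      (-(c / α) * (psiKer c α β (x - y) *
        (u y - (c / α) * (∫ z in y..s, (y - z) * u z) + (c / β) * (s - y) * X))) y := by
    intro y
    refine (((hasDerivAt_psiKer_sub c α β x y hc hα).mul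
      (((hasDerivAt_integral_lower hu s y).const_mul (c / α)).add_const ((c / β) * X))).add
      ((hasDerivAt_cos_sub c α β x y hc hα).mul
        (((hasDerivAt_integral_sub_mul hu s y).const_mul (c / α)).sub
          ((((hasDerivAt_id' y).const_sub s).const_mul (c / β)).mul_const X)))).congr_deriv ?_
    simp only [Pi.sub_apply]
    ring
  rw [← integral_const_mul, integral_eq_sub_of_hasDerivAt (fun y _ => hderiv y)
    (Continuous.intervalIntegrable (by fun_prop) _ _)]
  simp [psiKer]

/-- **Inverse transformation for the controller backstepping.** If continuous `û`, `ŵ`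
on `[0,s]` are related by the direct transformation
`ŵ(x) = û(x) − (c/α)∫_x^s (x−y) û(y) dy + (c/β)(s−x) X`, then
`û(x) = ŵ(x) + (β/α)∫_x^s ψ(x−y) ŵ(y) dy + ψ(x−s) X` on `[0,s]`. -/
theorem controller_backstepping_inverse
    (c α β s X : ℝ) (hc : 0 < c) (hα : 0 < α) (hβ : 0 < β) (hs : 0 < s)
    (uh wh : ℝ → ℝ)
    (huc : ContinuousOn uh (Set.Icc 0 s)) (hwc : ContinuousOn wh (Set.Icc 0 s))
    (hdirect : ∀ x ∈ Set.Icc 0 s,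
      wh x = uh x - (c/α) * (∫ y in x..s, (x - y) * uh y) + (c/β) * (s - x) * X) :
    ∀ x ∈ Set.Icc 0 s,
      uh x = wh x + (β/α) * (∫ y in x..s, psiKer c α β (x - y) * wh y)
        + psiKer c α β (x - s) * X := by
  intro x hx
  set u := Set.IccExtend hs.le ((Set.Icc 0 s).domRestrict uh) with hu_def
  have hu : Continuous u := huc.domRestrict.Icc_extend'
  have hux : ∀ y ∈ Set.Icc 0 s, u y = uh y := fun y hy => by
    rw [hu_def, Set.IccExtend_of_mem _ _ hy, Set.domRestrict_apply]
  have hsub : ∀ y ∈ Set.Icc 0 s, Set.uIcc y s ⊆ Set.Icc 0 s := fun y hy => by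
    rw [Set.uIcc_of_le hy.2]
    exact Set.Icc_subset_Icc_left hy.1
  have hint : ∀ y ∈ Set.Icc 0 s,
      (∫ z in y..s, (y - z) * u z) = ∫ z in y..s, (y - z) * uh z := fun y hy =>
    integral_congr fun z hz => by simp only [hux z (hsub y hy hz)]
  have hw : (∫ y in x..s, psiKer c α β (x - y) *
        (u y - (c / α) * (∫ z in y..s, (y - z) * u z) + (c / β) * (s - y) * X)) =
      ∫ y in x..s, psiKer c α β (x - y) * wh y :=
    integral_congr fun y hy => by
      have hy' := hsub x hx hy
      simp only [hux y hy', hint y hy', hdirect y hy']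
  have key := integral_psiKer_mul_direct c α β s X hc hα hu x
  rw [hw, hint x hx] at key
  rw [hdirect x hx]
  generalize (∫ y in x..s, psiKer c α β (x - y) * wh y) = J at key ⊢
  generalize (∫ z in x..s, (x - z) * uh z) = I at key ⊢
  have hcancel : β / c * (c / β) = 1 := by field_simp
  have hcoef : β / c * (c / α) = β / α := by field_simp
  linear_combination (β / c) * key + J * hcoef +
    (psiKer c α β (x - s) * X - ((c / α) * I - (c / β) * (s - x) * X)) * hcancel
end
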